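/- Let P be the real vector space ℂ[x] of polynomials in x with complex coefficients, equipped with the trilinear product [Σ αᵣxʳ, Σ βₛxˢ, Σ γₜxᵗ] = Σᵣ Σₛ Σₜ (αᵣ β̄ₛ − ᾱᵣ βₛ)(γₜ + γ̄ₜ) x^{r+s+t}, where ᾱ denotes complex conjugation. Then P is a Lie triple system over ℝ; the span I of {xⁿ : n ≥ 4} is an ideal of P; in the quotient Lie triple system S = P/I, the subspace T = {ᾱ₀ + ᾱ₂x² + ᾱ₃x³ : α₀, α₂, α₃ ∈ ℂ} (bars denoting cosets mod I) is a subsystem of S; S is a weak system of quotients of T, but S is not a system of quotients of T. -/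

import Mathlib

/-- A Lie triple system structure on an `F`-vector space `S`:
a trilinear map `b` satisfying `[x,x,z] = 0`, the cyclic identity and the
Leibniz (derivation) identity. -/
structure LTSStruct (F : Type*) (S : Type*) [Field F] [AddCommGroup S] [Module F S] where
  b : S → S → S → S
  add₁ : ∀ x x' y z, b (x + x') y z = b x y z + b x' y z
  smul₁ : ∀ (c : F) (x y z : S), b (c • x) y z = c • b x y z
  add₂ : ∀ x y y' z, b x (y + y') z = b x y z + b x y' z
  smul₂ : ∀ (c : F) (x y z : S), b x (c • y) z = c • b x y z
  add₃ : ∀ x y z z', b x y (z + z') = b x y z + b x y z'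
  smul₃ : ∀ (c : F) (x y z : S), b x y (c • z) = c • b x y z
  alt : ∀ x z, b x x z = 0
  cyclic : ∀ x y z, b x y z + b y z x + b z x y = 0
  leibniz : ∀ u v x y z,
    b u v (b x y z) = b (b u v x) y z + b x (b u v y) z + b x y (b u v z)

namespace LTSStruct

variable {F : Type*} [Field F] {S : Type*} [AddCommGroup S] [Module F S]

/-- `I` is an ideal of the whole Lie triple system `S`: `[I,S,S] ⊆ I`. -/
def IsIdeal (L : LTSStruct F S) (I : Submodule F S) : Prop :=
  ∀ x ∈ I, ∀ y z : S, L.b x y z ∈ I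

/-- `T` is a subsystem of `S`: `[T,T,T] ⊆ T`. -/
def IsSubsystem (L : LTSStruct F S) (T : Submodule F S) : Prop :=
  ∀ x ∈ T, ∀ y ∈ T, ∀ z ∈ T, L.b x y z ∈ T

/-- `I` is an ideal of the subsystem `T`: `I ⊆ T` and `[I,T,T] ⊆ I`. -/
def IsIdealOf (L : LTSStruct F S) (I T : Submodule F S) : Prop :=
  I ≤ T ∧ ∀ x ∈ I, ∀ y ∈ T, ∀ z ∈ T, L.b x y z ∈ I

/-- The centralizer of a subset `I` in the whole system `S`:
`C_S(I) = {x ∈ S : [x,I,S] = [S,I,x] = 0}`. -/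
def centralizer (L : LTSStruct F S) (I : Set S) : Set S :=
  {x | (∀ i ∈ I, ∀ t : S, L.b x i t = 0) ∧ (∀ t : S, ∀ i ∈ I, L.b t i x = 0)}

/-- The centralizer of a subset `I` in a subsystem `T`:
`C_T(I) = {x ∈ T : [x,I,T] = [T,I,x] = 0}`. -/
def relCentralizer (L : LTSStruct F S) (T : Submodule F S) (I : Set S) : Set S :=
  {x | x ∈ T ∧ (∀ i ∈ I, ∀ t ∈ T, L.b x i t = 0) ∧ (∀ t ∈ T, ∀ i ∈ I, L.b t i x = 0)}

/-- The center `C(S) = {x ∈ S : [x,S,S] = 0}`. -/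
def center (L : LTSStruct F S) : Set S := {x | ∀ y z : S, L.b x y z = 0}

/-- The center of a subsystem `T`: `C(T) = {x ∈ T : [x,T,T] = 0}`. -/
def relCenter (L : LTSStruct F S) (T : Submodule F S) : Set S :=
  {x | x ∈ T ∧ ∀ y ∈ T, ∀ z ∈ T, L.b x y z = 0}

/-- `S` is semiprime: `[S,I,I] ≠ 0` for every nonzero ideal `I`. -/
def IsSemiprime (L : LTSStruct F S) : Prop :=
  ∀ I : Submodule F S, L.IsIdeal I → I ≠ ⊥ → ∃ t : S, ∃ i ∈ I, ∃ j ∈ I, L.b t i j ≠ 0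

/-- `S` is prime: `[S,I,J] ≠ 0` for all nonzero ideals `I`, `J`. -/
def IsPrime (L : LTSStruct F S) : Prop :=
  ∀ I J : Submodule F S, L.IsIdeal I → L.IsIdeal J → I ≠ ⊥ → J ≠ ⊥ →
    ∃ t : S, ∃ i ∈ I, ∃ j ∈ J, L.b t i j ≠ 0

/-- `S` is nondegenerate: `[S,x,x] ≠ 0` for every nonzero `x`. -/
def IsNondegenerate (L : LTSStruct F S) : Prop :=
  ∀ x : S, x ≠ 0 → ∃ t : S, L.b t x x ≠ 0

/-- A subsystem `T` is semiprime: `[T,I,I] ≠ 0` for every nonzero ideal `I` of `T`. -/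
def RelSemiprime (L : LTSStruct F S) (T : Submodule F S) : Prop :=
  ∀ I : Submodule F S, L.IsIdealOf I T → I ≠ ⊥ → ∃ t ∈ T, ∃ i ∈ I, ∃ j ∈ I, L.b t i j ≠ 0

/-- A subsystem `T` is prime: `[T,I,J] ≠ 0` for all nonzero ideals `I`, `J` of `T`. -/
def RelPrime (L : LTSStruct F S) (T : Submodule F S) : Prop :=
  ∀ I J : Submodule F S, L.IsIdealOf I T → L.IsIdealOf J T → I ≠ ⊥ → J ≠ ⊥ →
    ∃ t ∈ T, ∃ i ∈ I, ∃ j ∈ J, L.b t i j ≠ 0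

/-- A subsystem `T` is nondegenerate: `[T,x,x] ≠ 0` for every nonzero `x ∈ T`. -/
def RelNondegenerate (L : LTSStruct F S) (T : Submodule F S) : Prop :=
  ∀ x ∈ T, x ≠ 0 → ∃ t ∈ T, L.b t x x ≠ 0

/-- An ideal `I` of `S` is essential if it hits every nonzero ideal of `S`. -/
def IsEssentialIdeal (L : LTSStruct F S) (I : Submodule F S) : Prop :=
  L.IsIdeal I ∧ ∀ J : Submodule F S, L.IsIdeal J → J ≠ ⊥ → I ⊓ J ≠ ⊥

/-- An ideal `I` of the subsystem `T` is essential in `T` if it hits every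
nonzero ideal of `T`. -/
def IsEssentialIdealOf (L : LTSStruct F S) (I T : Submodule F S) : Prop :=
  L.IsIdealOf I T ∧ ∀ J : Submodule F S, L.IsIdealOf J T → J ≠ ⊥ → I ⊓ J ≠ ⊥

/-- The elements `s`, `R(x₁,y₁)⋯R(xₙ,yₙ)(s)` with all `xᵢ, yᵢ ∈ T`, where
`R(x,y)(z) = [z,x,y]`. -/
inductive InIter (L : LTSStruct F S) (T : Submodule F S) (s : S) : S → Prop
  | base : InIter L T s s
  | step (z x y : S) : InIter L T s z → x ∈ T → y ∈ T → InIter L T s (L.b z x y)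

/-- `_T(s)`: the linear span in `S` of `s` and all `R(x₁,y₁)⋯R(xₙ,yₙ)(s)`,
`xᵢ, yᵢ ∈ T`. -/
def innerIdeal (L : LTSStruct F S) (T : Submodule F S) (s : S) : Submodule F S :=
  Submodule.span F {z | InIter L T s z}

/-- `(T:s) = {x ∈ T : [x,T,_T(s)] + [x,_T(s),T] ⊆ T}`. -/
def quotSet (L : LTSStruct F S) (T : Submodule F S) (s : S) : Set S :=
  {x | x ∈ T ∧ ∀ t ∈ T, ∀ u ∈ L.innerIdeal T s, L.b x t u ∈ T ∧ L.b x u t ∈ T}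

/-- `S` is a system of quotients of `T`. -/
def IsSystemOfQuotients (L : LTSStruct F S) (T : Submodule F S) : Prop :=
  L.IsSubsystem T ∧ ∀ s s' : S, s ≠ 0 →
    ∃ x ∈ T, ∃ y ∈ T, L.b s x y ≠ 0 ∧ (x ∈ L.quotSet T s' ∨ y ∈ L.quotSet T s')

/-- `S` is a weak system of quotients of `T`. -/
def IsWeakSystemOfQuotients (L : LTSStruct F S) (T : Submodule F S) : Prop :=
  L.IsSubsystem T ∧ ∀ s : S, s ≠ 0 → ∃ x ∈ T, ∃ y ∈ T, L.b s x y ≠ 0 ∧ L.b s x y ∈ T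

/-- `S` is ideally absorbed into `T`: for every `0 ≠ s ∈ S` there is an ideal `I`
of `T` with `C_T(I) = 0` and `0 ≠ [s,I,T] + [s,T,I] ⊆ T`. -/
def IsIdeallyAbsorbed (L : LTSStruct F S) (T : Submodule F S) : Prop :=
  L.IsSubsystem T ∧ ∀ s : S, s ≠ 0 → ∃ I : Submodule F S, L.IsIdealOf I T ∧
    L.relCentralizer T (I : Set S) = {0} ∧
    (∃ i ∈ I, ∃ t ∈ T, L.b s i t ≠ 0 ∨ L.b s t i ≠ 0) ∧
    (∀ i ∈ I, ∀ t ∈ T, L.b s i t ∈ T ∧ L.b s t i ∈ T)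

end LTSStruct

open Polynomial in
/-- Coefficientwise complex conjugation of a polynomial. -/
noncomputable def pconj (p : Polynomial ℂ) : Polynomial ℂ := p.map (starRingEnd ℂ)

open Polynomial in
/-- The triple product
`[Σ αᵣxʳ, Σ βₛxˢ, Σ γₜxᵗ] = Σᵣₛₜ (αᵣ β̄ₛ − ᾱᵣ βₛ)(γₜ + γ̄ₜ) x^(r+s+t)`,
i.e. `(p · q̄ − p̄ · q) · (r + r̄)`. -/
noncomputable def tripleP (p q r : Polynomial ℂ) : Polynomial ℂ :=
  (p * pconj q - pconj p * q) * (r + pconj r)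

open Polynomial in
/-- The (complex) span of `{xⁿ : n ≥ 4}` inside `ℂ[x]` viewed as a real vector
space, i.e. the real span of `{c · xⁿ : c ∈ ℂ, n ≥ 4}`. -/
noncomputable def Iid : Submodule ℝ (Polynomial ℂ) :=
  Submodule.span ℝ {p | ∃ (c : ℂ) (n : ℕ), 4 ≤ n ∧ p = Polynomial.C c * Polynomial.X ^ n}

open Polynomial in
/-- The subspace `{α₀ + α₂x² + α₃x³ : α₀, α₂, α₃ ∈ ℂ}` of `ℂ[x]`. -/
noncomputable def Wsub : Submodule ℝ (Polynomial ℂ) :=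
  Submodule.span ℝ {p | ∃ c : ℂ,
    p = Polynomial.C c ∨ p = Polynomial.C c * Polynomial.X ^ 2 ∨
      p = Polynomial.C c * Polynomial.X ^ 3}

/-- The image `T = {ᾱ₀ + ᾱ₂x² + ᾱ₃x³}` of `Wsub` in the quotient `S = P/I`. -/
noncomputable def Tsub : Submodule ℝ (Polynomial ℂ ⧸ Iid) := Wsub.map Iid.mkQ

namespace LTSStruct

variable {F : Type*} [Field F] {S : Type*} [AddCommGroup S] [Module F S]

theorem b_antisymm (L : LTSStruct F S) (x y z : S) : L.b x y z = -L.b y x z := by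
  have h := L.alt (x + y) z
  rw [L.add₁, L.add₂, L.add₂, L.alt, L.alt, zero_add, add_zero] at h
  exact eq_neg_of_add_eq_zero_left h

theorem IsIdeal.b_mem₂ {L : LTSStruct F S} {I : Submodule F S} (hI : L.IsIdeal I)
    (x z : S) {y : S} (hy : y ∈ I) : L.b x y z ∈ I := by
  rw [L.b_antisymm]
  exact I.neg_mem (hI y hy x z)

theorem IsIdeal.b_mem₃ {L : LTSStruct F S} {I : Submodule F S} (hI : L.IsIdeal I)
    (x y : S) {z : S} (hz : z ∈ I) : L.b x y z ∈ I := by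
  have h := L.cyclic x y z
  rw [add_assoc] at h
  rw [eq_neg_of_add_eq_zero_left h]
  exact I.neg_mem (I.add_mem (hI.b_mem₂ y x hz) (hI z hz x y))

theorem IsIdeal.mkQ_b_congr {L : LTSStruct F S} {I : Submodule F S} (hI : L.IsIdeal I)
    {x x' y y' z z' : S} (hx : I.mkQ x = I.mkQ x') (hy : I.mkQ y = I.mkQ y')
    (hz : I.mkQ z = I.mkQ z') : I.mkQ (L.b x y z) = I.mkQ (L.b x' y' z') := by
  simp only [Submodule.mkQ_apply, Submodule.Quotient.eq] at hx hy hz ⊢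
  have e₁ : L.b x y z = L.b (x - x') y z + L.b x' y z := by rw [← L.add₁, sub_add_cancel]
  have e₂ : L.b x' y z = L.b x' (y - y') z + L.b x' y' z := by rw [← L.add₂, sub_add_cancel]
  have e₃ : L.b x' y' z = L.b x' y' (z - z') + L.b x' y' z' := by rw [← L.add₃, sub_add_cancel]
  rw [e₁, e₂, e₃, ← add_assoc, ← add_assoc, add_sub_cancel_right]
  exact I.add_mem (I.add_mem (hI _ hx _ _) (hI.b_mem₂ _ _ hy)) (hI.b_mem₃ _ _ hz)

/-- The triple product induced on the quotient by a submodule, computed on representatives. -/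
noncomputable def quotientB (L : LTSStruct F S) (I : Submodule F S) (x y z : S ⧸ I) : S ⧸ I :=
  I.mkQ (L.b (Function.surjInv I.mkQ_surjective x) (Function.surjInv I.mkQ_surjective y)
    (Function.surjInv I.mkQ_surjective z))

theorem IsIdeal.quotientB_mkQ {L : LTSStruct F S} {I : Submodule F S} (hI : L.IsIdeal I)
    (x y z : S) : L.quotientB I (I.mkQ x) (I.mkQ y) (I.mkQ z) = I.mkQ (L.b x y z) :=
  hI.mkQ_b_congr (Function.surjInv_eq _ _) (Function.surjInv_eq _ _) (Function.surjInv_eq _ _)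

/-- The quotient of a Lie triple system by an ideal. -/
noncomputable def quotient (L : LTSStruct F S) (I : Submodule F S) (hI : L.IsIdeal I) :
    LTSStruct F (S ⧸ I) where
  b := L.quotientB I
  add₁ := by
    simp only [I.mkQ_surjective.forall, ← map_add, hI.quotientB_mkQ, L.add₁, implies_true]
  smul₁ := by
    simp only [I.mkQ_surjective.forall, ← map_smul, hI.quotientB_mkQ, L.smul₁, implies_true]
  add₂ := by
    simp only [I.mkQ_surjective.forall, ← map_add, hI.quotientB_mkQ, L.add₂, implies_true]
  smul₂ := by
    simp only [I.mkQ_surjective.forall, ← map_smul, hI.quotientB_mkQ, L.smul₂, implies_true]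
  add₃ := by
    simp only [I.mkQ_surjective.forall, ← map_add, hI.quotientB_mkQ, L.add₃, implies_true]
  smul₃ := by
    simp only [I.mkQ_surjective.forall, ← map_smul, hI.quotientB_mkQ, L.smul₃, implies_true]
  alt := by
    simp only [I.mkQ_surjective.forall, hI.quotientB_mkQ, L.alt, map_zero, implies_true]
  cyclic := by
    simp only [I.mkQ_surjective.forall, hI.quotientB_mkQ, ← map_add, L.cyclic, map_zero,
      implies_true]
  leibniz := by
    simp only [I.mkQ_surjective.forall, hI.quotientB_mkQ, ← map_add]
    exact fun u v x y z => congrArg I.mkQ (L.leibniz u v x y z)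

theorem quotient_b_mkQ (L : LTSStruct F S) (I : Submodule F S) (hI : L.IsIdeal I) (x y z : S) :
    (L.quotient I hI).b (I.mkQ x) (I.mkQ y) (I.mkQ z) = I.mkQ (L.b x y z) :=
  hI.quotientB_mkQ x y z

end LTSStruct

open Polynomial ComplexConjugate

theorem pconj_add (p q : ℂ[X]) : pconj (p + q) = pconj p + pconj q := Polynomial.map_add _

theorem pconj_sub (p q : ℂ[X]) : pconj (p - q) = pconj p - pconj q := Polynomial.map_sub _

theorem pconj_mul (p q : ℂ[X]) : pconj (p * q) = pconj p * pconj q := Polynomial.map_mul _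

theorem pconj_pconj (p : ℂ[X]) : pconj (pconj p) = p := by
  ext n
  simp [pconj]

theorem pconj_real_smul (c : ℝ) (p : ℂ[X]) : pconj (c • p) = c • pconj p := by
  ext n
  simp [pconj]

theorem coeff_pconj (p : ℂ[X]) (n : ℕ) : (pconj p).coeff n = conj (p.coeff n) := coeff_map _ _

theorem X_pow_dvd_pconj {n : ℕ} {p : ℂ[X]} (hp : X ^ n ∣ p) : X ^ n ∣ pconj p := by
  simpa [pconj] using Polynomial.map_dvd (starRingEnd ℂ) hp

theorem X_dvd_pconj {p : ℂ[X]} (hp : X ∣ p) : X ∣ pconj p := by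
  simpa using X_pow_dvd_pconj (n := 1) (by simpa using hp)

/-- The Lie triple system of complex polynomials with product `tripleP`. -/
noncomputable def polynomialLTS : LTSStruct ℝ ℂ[X] where
  b := tripleP
  add₁ x x' y z := by simp only [tripleP, pconj_add]; ring
  smul₁ c x y z := by
    simp only [tripleP, pconj_real_smul, smul_mul_assoc, ← smul_sub]
  add₂ x y y' z := by simp only [tripleP, pconj_add]; ring
  smul₂ c x y z := by
    simp only [tripleP, pconj_real_smul, mul_smul_comm, smul_mul_assoc, ← smul_sub]
  add₃ x y z z' := by simp only [tripleP, pconj_add]; ring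
  smul₃ c x y z := by
    simp only [tripleP, pconj_real_smul, mul_smul_comm, ← smul_add]
  alt x z := by simp only [tripleP]; ring
  cyclic x y z := by simp only [tripleP]; ring
  leibniz u v x y z := by
    simp only [tripleP, pconj_add, pconj_sub, pconj_mul, pconj_pconj]; ring

theorem mem_Iid {p : ℂ[X]} : p ∈ Iid ↔ ∀ n < 4, p.coeff n = 0 := by
  constructor
  · intro hp n hn
    induction hp using Submodule.span_induction with
    | mem q hq =>
      obtain ⟨c, m, hm, rfl⟩ := hq
      rw [coeff_C_mul_X_pow, if_neg (by lia)]
    | zero => exact coeff_zero n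
    | add q r _ _ hq hr => rw [coeff_add, hq, hr, add_zero]
    | smul c q _ hq => rw [coeff_smul, hq, smul_zero]
  · intro hp
    rw [p.as_sum_support_C_mul_X_pow]
    refine Submodule.sum_mem _ fun n hn => Submodule.subset_span ⟨_, n, ?_, rfl⟩
    by_contra! h
    exact mem_support_iff.mp hn (hp n h)

theorem mkQ_Iid_eq_zero {p : ℂ[X]} : Iid.mkQ p = 0 ↔ ∀ n < 4, p.coeff n = 0 := by
  rw [Submodule.mkQ_apply, Submodule.Quotient.mk_eq_zero, mem_Iid]

theorem coeff_one_of_mem_Wsub {p : ℂ[X]} (hp : p ∈ Wsub) : p.coeff 1 = 0 := by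
  induction hp using Submodule.span_induction with
  | mem q hq =>
    obtain ⟨c, rfl | rfl | rfl⟩ := hq
    · exact coeff_C_of_ne_zero one_ne_zero
    all_goals rw [coeff_C_mul_X_pow, if_neg (by decide)]
  | zero => exact coeff_zero 1
  | add q r _ _ hq hr => rw [coeff_add, hq, hr, add_zero]
  | smul c q _ hq => rw [coeff_smul, hq, smul_zero]

theorem mkQ_mem_Tsub {p : ℂ[X]} : Iid.mkQ p ∈ Tsub ↔ p.coeff 1 = 0 := by
  constructor
  · rintro ⟨w, hw, h⟩
    have h1 := mem_Iid.mp ((Submodule.Quotient.eq _).mp h) 1 (by norm_num)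
    rw [coeff_sub, coeff_one_of_mem_Wsub hw, zero_sub, neg_eq_zero] at h1
    exact h1
  · intro hp
    refine ⟨C (p.coeff 0) + C (p.coeff 2) * X ^ 2 + C (p.coeff 3) * X ^ 3,
      add_mem (add_mem ?_ ?_) ?_, (Submodule.Quotient.eq _).mpr (mem_Iid.mpr ?_)⟩
    · exact Submodule.subset_span ⟨_, .inl rfl⟩
    · exact Submodule.subset_span ⟨_, .inr (.inl rfl)⟩
    · exact Submodule.subset_span ⟨_, .inr (.inr rfl)⟩
    · intro n hn
      interval_cases n <;> simp [coeff_X_pow, coeff_C, hp]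

theorem polynomialLTS_isIdeal_Iid : polynomialLTS.IsIdeal Iid := by
  intro p hp q r
  rw [mem_Iid, ← X_pow_dvd_iff] at hp ⊢
  exact dvd_mul_of_dvd_left (dvd_sub (dvd_mul_of_dvd_left hp _)
    (dvd_mul_of_dvd_left (X_pow_dvd_pconj hp) _)) _

theorem coeff_one_tripleP {p q r : ℂ[X]} (hp : p.coeff 1 = 0) (hq : q.coeff 1 = 0) :
    (tripleP p q r).coeff 1 = (p.coeff 0 * conj (q.coeff 0) - conj (p.coeff 0) * q.coeff 0) *
      (r.coeff 1 + conj (r.coeff 1)) := by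
  simp [tripleP, mul_coeff_one, mul_coeff_zero, coeff_pconj, hp, hq]

theorem coeff_tripleP_monomial_one (p : ℂ[X]) (c : ℂ) (a n : ℕ) :
    (tripleP p (C c * X ^ a) 1).coeff n =
      if a ≤ n then 2 * (conj c * p.coeff (n - a) - c * conj (p.coeff (n - a))) else 0 := by
  have h : tripleP p (C c * X ^ a) 1 = (C (2 * conj c) * p - C (2 * c) * pconj p) * X ^ a := by
    simp only [tripleP, pconj, Polynomial.map_mul, Polynomial.map_pow, map_X, map_C,
      Polynomial.map_one, C_mul]
    rw [show (C 2 : ℂ[X]) = 2 from rfl]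
    ring
  rw [h, coeff_mul_X_pow', coeff_sub, coeff_C_mul, coeff_C_mul, coeff_pconj]
  congr 1
  ring

theorem conj_I_mul_mul_sub_ne_zero {z : ℂ} (hz : z ≠ 0) :
    2 * (conj (Complex.I * z) * z - Complex.I * z * conj z) ≠ 0 := by
  have h : 2 * (conj (Complex.I * z) * z - Complex.I * z * conj z) =
      -4 * Complex.I * (z * conj z) := by
    rw [map_mul, Complex.conj_I]
    ring
  rw [h]
  simp [hz]

theorem isSubsystem_Tsub :
    (polynomialLTS.quotient Iid polynomialLTS_isIdeal_Iid).IsSubsystem Tsub := by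
  simp only [LTSStruct.IsSubsystem, Iid.mkQ_surjective.forall, LTSStruct.quotient_b_mkQ,
    mkQ_mem_Tsub]
  intro p hp q hq r hr
  exact (coeff_one_tripleP hp hq).trans (by simp [hr])

theorem isWeakSystemOfQuotients_Tsub :
    (polynomialLTS.quotient Iid polynomialLTS_isIdeal_Iid).IsWeakSystemOfQuotients Tsub := by
  refine ⟨isSubsystem_Tsub, ?_⟩
  simp only [Iid.mkQ_surjective.forall, Iid.mkQ_surjective.exists, LTSStruct.quotient_b_mkQ,
    mkQ_mem_Tsub, ne_eq, mkQ_Iid_eq_zero]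
  intro p hp
  have key : ∀ k a : ℕ, p.coeff k ≠ 0 → k + a < 4 → a ≠ 1 → (a = 0 → p.coeff 1 = 0) →
      ∃ x : ℂ[X], x.coeff 1 = 0 ∧ ∃ y : ℂ[X], y.coeff 1 = 0 ∧
        (¬ ∀ n < 4, (tripleP p x y).coeff n = 0) ∧ (tripleP p x y).coeff 1 = 0 := by
    intro k a hk hka ha h0
    refine ⟨C (Complex.I * p.coeff k) * X ^ a, ?_, 1, ?_, fun h => ?_, ?_⟩
    · rw [coeff_C_mul_X_pow, if_neg ha.symm]
    · exact coeff_one.trans (if_neg one_ne_zero)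
    · have h := h _ hka
      rw [coeff_tripleP_monomial_one, if_pos (by lia), Nat.add_sub_cancel] at h
      exact conj_I_mul_mul_sub_ne_zero hk h
    · rw [coeff_tripleP_monomial_one]
      split_ifs with h
      · obtain rfl : a = 0 := by lia
        simp [h0 rfl]
      · rfl
  by_cases h0 : p.coeff 0 = 0
  · by_cases h1 : p.coeff 1 = 0
    · push Not at hp
      obtain ⟨k, hk, hpk⟩ := hp
      exact key k 0 hpk hk (by decide) fun _ => h1
    · exact key 1 2 h1 (by decide) (by decide) (by simp)
  · exact key 0 3 h0 (by decide) (by decide) (by simp)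

theorem coeff_zero_of_mkQ_mem_quotSet {p : ℂ[X]}
    (hp : Iid.mkQ p ∈ (polynomialLTS.quotient Iid polynomialLTS_isIdeal_Iid).quotSet Tsub
      (Iid.mkQ X)) : p.coeff 0 = 0 := by
  obtain ⟨hpT, h⟩ := hp
  have h' := (h (Iid.mkQ (C (Complex.I * p.coeff 0))) (mkQ_mem_Tsub.mpr
    (coeff_C_of_ne_zero one_ne_zero)) _ (Submodule.subset_span .base)).1
  rw [LTSStruct.quotient_b_mkQ, mkQ_mem_Tsub] at h'
  replace h' :=
    (coeff_one_tripleP (mkQ_mem_Tsub.mp hpT) (coeff_C_of_ne_zero one_ne_zero)).symm.trans h'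
  rw [coeff_C_zero, coeff_X_one, map_one, mul_eq_zero] at h'
  by_contra h0
  apply conj_I_mul_mul_sub_ne_zero h0
  linear_combination 2 * h'.resolve_right (by norm_num)

theorem tripleP_X_pow_three_mem_Iid {p q : ℂ[X]} (h : p.coeff 0 = 0 ∨ q.coeff 0 = 0) :
    tripleP (X ^ 3) p q ∈ Iid := by
  have e : tripleP (X ^ 3) p q = X ^ 3 * ((pconj p - p) * (q + pconj q)) := by
    simp only [tripleP, pconj, Polynomial.map_pow, map_X]
    ring
  rw [mem_Iid, ← X_pow_dvd_iff, e, pow_succ]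
  refine mul_dvd_mul_left _ ?_
  simp only [← X_dvd_iff] at h
  rcases h with h | h
  · exact dvd_mul_of_dvd_left (dvd_sub (X_dvd_pconj h) h) _
  · exact dvd_mul_of_dvd_right (dvd_add h (X_dvd_pconj h)) _

theorem not_isSystemOfQuotients_Tsub :
    ¬ (polynomialLTS.quotient Iid polynomialLTS_isIdeal_Iid).IsSystemOfQuotients Tsub := by
  rintro ⟨-, h⟩
  obtain ⟨x, -, y, -, hne, hxy⟩ := h (Iid.mkQ (X ^ 3)) (Iid.mkQ X) fun h0 => by
    simpa using mkQ_Iid_eq_zero.mp h0 3 (by decide)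
  obtain ⟨p, rfl⟩ := Iid.mkQ_surjective x
  obtain ⟨q, rfl⟩ := Iid.mkQ_surjective y
  rw [LTSStruct.quotient_b_mkQ] at hne
  exact hne ((Submodule.Quotient.mk_eq_zero _).mpr (tripleP_X_pow_three_mem_Iid
    (hxy.imp coeff_zero_of_mkQ_mem_quotSet coeff_zero_of_mkQ_mem_quotSet)))

/-- `P = ℂ[x]` with the product
`[p, q, r] = (p q̄ − p̄ q)(r + r̄)` is a Lie triple system over `ℝ`; the span
`I` of `{xⁿ : n ≥ 4}` is an ideal of `P`; in the quotient `S = P/I` the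
subspace `T = {ᾱ₀ + ᾱ₂x² + ᾱ₃x³}` is a subsystem; `S` is a weak system of
quotients of `T` but not a system of quotients of `T`. -/
theorem polynomial_weak_but_not_system_of_quotients :
    ∃ LP : LTSStruct ℝ (Polynomial ℂ),
      (∀ p q r : Polynomial ℂ, LP.b p q r = tripleP p q r) ∧
      LP.IsIdeal Iid ∧
      ∃ LS : LTSStruct ℝ (Polynomial ℂ ⧸ Iid),
        (∀ p q r : Polynomial ℂ,
          LS.b (Iid.mkQ p) (Iid.mkQ q) (Iid.mkQ r) = Iid.mkQ (tripleP p q r)) ∧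
        LS.IsSubsystem Tsub ∧
        LS.IsWeakSystemOfQuotients Tsub ∧
        ¬ LS.IsSystemOfQuotients Tsub := by
  exact ⟨polynomialLTS, fun _ _ _ => rfl, polynomialLTS_isIdeal_Iid,
    polynomialLTS.quotient Iid polynomialLTS_isIdeal_Iid,
    polynomialLTS.quotient_b_mkQ Iid polynomialLTS_isIdeal_Iid,
    isSubsystem_Tsub, isWeakSystemOfQuotients_Tsub, not_isSystemOfQuotients_Tsub⟩
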